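/- Let R ∈ (0,1) and τ ∈ (0, (1−R)/4] be real numbers. Define F : [0, τ] → ℝ by F(ι) = H(ι) + ι·log₂3 + (1−R)·H((τ−ι)/(1−R)), where H(x) = −x·log₂x − (1−x)·log₂(1−x) is the binary entropy function (with H(0) = H(1) = 0), and set ι* = 1 − R/4 + τ/2 − (1/4)·√(16 − 8R − 8τ + R² − 4Rτ + 4τ²). Then 0 < ι* < τ and F attains its maximum over [0, τ] at ι*, i.e., F(ι) ≤ F(ι*) for all ι ∈ [0, τ]. -/

import Mathlib

noncomputable section

/-- The binary entropy function `H(x) = −x log₂ x − (1−x) log₂ (1−x)`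
(with the convention `H(0) = H(1) = 0`, automatic since `logb 2 0 = 0`). -/
def binEnt (x : ℝ) : ℝ := -x * Real.logb 2 x - (1 - x) * Real.logb 2 (1 - x)

/-- The pointwise form of Gibbs' inequality. -/
lemma mul_log_sub_mul_log_le {x q : ℝ} (hx : 0 ≤ x) (hq : 0 < q) :
    x * Real.log q - x * Real.log x ≤ q - x := by
  rcases hx.eq_or_lt with rfl | hx
  · simpa using hq.le
  · have h := mul_le_mul_of_nonneg_left (Real.log_le_sub_one_of_pos (div_pos hq hx)) hx.le
    rw [Real.log_div hq.ne' hx.ne', mul_sub, mul_sub, mul_div_cancel₀ _ hx.ne'] at h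
    linarith

/-- Gibbs' inequality: the binary entropy is at most the cross-entropy, i.e. the graph of `binEnt`
lies below its tangent line at `q`. -/
lemma binEnt_le_tangent {x q : ℝ} (hx0 : 0 ≤ x) (hx1 : x ≤ 1) (hq0 : 0 < q) (hq1 : q < 1) :
    binEnt x ≤ binEnt q + (x - q) * (Real.logb 2 (1 - q) - Real.logb 2 q) := by
  have h1 := mul_log_sub_mul_log_le hx0 hq0
  have h2 := mul_log_sub_mul_log_le (sub_nonneg.2 hx1) (sub_pos.2 hq1)
  have hlog : 0 < Real.log 2 := Real.log_pos one_lt_two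
  have h : 0 ≤ ((q - x) - (x * Real.log q - x * Real.log x) + (((1 - q) - (1 - x)) -
      ((1 - x) * Real.log (1 - q) - (1 - x) * Real.log (1 - x)))) / Real.log 2 :=
    div_nonneg (by linarith) hlog.le
  rw [← sub_nonneg]
  convert h using 1
  simp only [binEnt, Real.logb]
  field_simp
  ring

/-- **Maximization of the exponent in the asymptotic Hamming bound for nondegenerate DS
codes**: `F(ι) = H(ι) + ι log₂ 3 + (1−R) H((τ−ι)/(1−R))` attains its maximum over `[0, τ]`
at `ι* = 1 − R/4 + τ/2 − (1/4)√(16 − 8R − 8τ + R² − 4Rτ + 4τ²)`, and `0 < ι* < τ`. -/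
theorem hamming_exponent_maximizer (R τ : ℝ) (hR0 : 0 < R) (hR1 : R < 1)
    (hτ0 : 0 < τ) (hτ : τ ≤ (1 - R) / 4)
    (F : ℝ → ℝ)
    (hF : ∀ ι, F ι = binEnt ι + ι * Real.logb 2 3 + (1 - R) * binEnt ((τ - ι) / (1 - R)))
    (ιs : ℝ)
    (hιs : ιs = 1 - R / 4 + τ / 2 -
      (1 / 4) * Real.sqrt (16 - 8 * R - 8 * τ + R ^ 2 - 4 * R * τ + 4 * τ ^ 2)) :
    0 < ιs ∧ ιs < τ ∧ ∀ ι ∈ Set.Icc (0 : ℝ) τ, F ι ≤ F ιs := by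
  have hD : 16 - 8 * R - 8 * τ + R ^ 2 - 4 * R * τ + 4 * τ ^ 2 =
      (4 - R - 2 * τ) ^ 2 + 8 * τ * (1 - R) := by ring
  have hgap : 0 < 8 * τ * (1 - R) := by nlinarith
  have hsq := Real.sq_sqrt (show 0 ≤ 16 - 8 * R - 8 * τ + R ^ 2 - 4 * R * τ + 4 * τ ^ 2 by
    rw [hD]; positivity)
  have hs0 := Real.sqrt_nonneg (16 - 8 * R - 8 * τ + R ^ 2 - 4 * R * τ + 4 * τ ^ 2)
  set s := Real.sqrt (16 - 8 * R - 8 * τ + R ^ 2 - 4 * R * τ + 4 * τ ^ 2)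
  have hs_lt : s < 4 + 2 * τ - R := by
    apply lt_of_pow_lt_pow_left₀ 2 (by linarith)
    nlinarith
  have hlt_s : 4 - R - 2 * τ < s := by
    apply lt_of_pow_lt_pow_left₀ 2 hs0
    linarith
  have hpos : 0 < ιs := by linarith
  have hlt : ιs < τ := by linarith
  have hcrit : (1 - ιs) * 3 * (τ - ιs) = ιs * (1 - R - (τ - ιs)) := by
    rw [hιs]
    linear_combination (1 / 8) * hsq
  refine ⟨hpos, hlt, fun ι ⟨hι0, hιτ⟩ => ?_⟩
  have hR : 0 < 1 - R := sub_pos.2 hR1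
  have hp0 : 0 < (τ - ιs) / (1 - R) := div_pos (by linarith) hR
  have hp1 : (τ - ιs) / (1 - R) < 1 := (div_lt_one hR).2 (by linarith)
  have hH := binEnt_le_tangent hι0 (show ι ≤ 1 by linarith) hpos (show ιs < 1 by linarith)
  have hH' := mul_le_mul_of_nonneg_left (binEnt_le_tangent
    (div_nonneg (sub_nonneg.2 hιτ) hR.le) ((div_le_one hR).2 (by linarith)) hp0 hp1) hR.le
  have hdiff : (1 - R) * ((τ - ι) / (1 - R) - (τ - ιs) / (1 - R)) = ιs - ι := by
    field_simp
    ring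
  rw [mul_add, ← mul_assoc, hdiff] at hH'
  have hstat : Real.logb 2 (1 - ιs) + Real.logb 2 3 + Real.logb 2 ((τ - ιs) / (1 - R)) =
      Real.logb 2 ιs + Real.logb 2 (1 - (τ - ιs) / (1 - R)) := by
    have h1 : 1 - ιs ≠ 0 := by linarith
    have h2 : 1 - (τ - ιs) / (1 - R) ≠ 0 := by linarith
    rw [← Real.logb_mul h1 three_ne_zero, ← Real.logb_mul (mul_ne_zero h1 three_ne_zero) hp0.ne',
      ← Real.logb_mul hpos.ne' h2]
    congr 1
    field_simp
    exact hcrit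
  rw [hF, hF]
  linear_combination hH + hH' + (ι - ιs) * hstat

end
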